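/- arXiv:1703.02493 — 2 statements merged into one kernel-verified Lean document; each statement's English description precedes it below -/
import Mathlib

section
/- Let f : ℝ^m → ℝ^n be a polynomial map of degree d with coefficient tensor Q ∈ ℝ^{n×m×δ}, and let L_Q ⊆ ℝ^{n×m×δ} denote the linear subspace of all tensors arising as the coefficient tensor of some polynomial map ℝ^m → ℝ^n of degree d. Then f admits a decoupled representation f(u) = Σ_{k=1}^r w_k g_k(v_k^T u) with r branches if and only if Q can be written as Q = Q_1 + ⋯ + Q_r, where each Q_k has CP rank at most 1 and Q_k ∈ L_Q. -/
open scoped BigOperators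

/-- Index set of size `δ = Σ_{k=1}^d m^{k-1}`: the block of degree `(s:ℕ)+1` (for `s : Fin d`)
is indexed by tuples of length `s`. -/
abbrev DeltaIdx (m d : ℕ) : Type := Σ s : Fin d, (Fin (s : ℕ) → Fin m)

/-- A tensor of order `s` and dimension `m` (indexed by tuples) is symmetric if its entries
are invariant under all permutations of the indices. -/
def SymT {m s : ℕ} (T : (Fin s → Fin m) → ℝ) : Prop :=
  ∀ (σ : Equiv.Perm (Fin s)) (α : Fin s → Fin m), T (α ∘ σ) = T α

/-- The polynomial map `ℝ^m → ℝ^n` of degree `d` (zero constant term) determined by the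
symmetric tensors `Φ i s` of the degree-`(s+1)` homogeneous parts of its components. -/
def polyEval {m n d : ℕ}
    (Φ : (i : Fin n) → (s : Fin d) → (Fin ((s : ℕ) + 1) → Fin m) → ℝ)
    (u : Fin m → ℝ) (i : Fin n) : ℝ :=
  ∑ s : Fin d, ∑ α : Fin ((s : ℕ) + 1) → Fin m, Φ i s α * ∏ t, u (α t)

/-- The coefficient tensor `Q ∈ ℝ^{n×m×δ}`, with slices `Q_{i,:,:} = Ψ(f_i)` given by
first-mode unfoldings of the symmetric tensors of `f_i`. -/
def coeffTensor {m n d : ℕ}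
    (Φ : (i : Fin n) → (s : Fin d) → (Fin ((s : ℕ) + 1) → Fin m) → ℝ) :
    Fin n → Fin m → DeltaIdx m d → ℝ :=
  fun i j p => Φ i p.1 (Fin.cons j p.2)

/-- The Jacobian tensor `J ∈ ℝ^{n×m×N}` of `f` at sampling points `pts`:
`J i j l = ∂f_i/∂u_j (pts l)`. -/
noncomputable def jacTensor {m n N : ℕ} (f : (Fin m → ℝ) → Fin n → ℝ)
    (pts : Fin N → Fin m → ℝ) : Fin n → Fin m → Fin N → ℝ :=
  fun i j l => fderiv ℝ (fun x => f x i) (pts l) (Pi.single j 1)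

/-- The Vandermonde-like matrix `A ∈ ℝ^{δ×N}`: in the block of degree `(s:ℕ)+1`, the `j`-th
column equals `((s:ℕ)+1)` times the `s`-fold Kronecker power of the sampling point. -/
def vdm (m d N : ℕ) (pts : Fin N → Fin m → ℝ) : Matrix (DeltaIdx m d) (Fin N) ℝ :=
  Matrix.of fun p j => ((p.1 : ℕ) + 1 : ℝ) * ∏ i, pts j (p.2 i)

/-- The structured vector `z = [c_1 | c_2 v^T | c_3 (v⊗v)^T | ⋯ ]^T ∈ ℝ^δ`. -/
def zVec {m : ℕ} (d : ℕ) (c : Fin d → ℝ) (v : Fin m → ℝ) : DeltaIdx m d → ℝ :=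
  fun p => c p.1 * ∏ i, v (p.2 i)

/-- `T = Σ_{k=1}^r a_k ∘ b_k ∘ c_k` is a CP decomposition with `r` terms. -/
def IsCPDecomp {I J K : Type*} (r : ℕ) (T : I → J → K → ℝ)
    (a : Fin r → I → ℝ) (b : Fin r → J → ℝ) (c : Fin r → K → ℝ) : Prop :=
  ∀ i j k, T i j k = ∑ l, a l i * b l j * c l k

/-- The CP rank of a third-order tensor. -/
noncomputable def cpRank {I J K : Type*} (T : I → J → K → ℝ) : ℕ :=
  sInf {r | ∃ a b c, IsCPDecomp r T a b c}

/-- Essential uniqueness of the CP decomposition with `r` terms: any two decompositions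
coincide up to permutation of the terms and scalings with product `1` within each term. -/
def EssUnique {I J K : Type*} (r : ℕ) (T : I → J → K → ℝ) : Prop :=
  ∀ (a a' : Fin r → I → ℝ) (b b' : Fin r → J → ℝ) (c c' : Fin r → K → ℝ),
    IsCPDecomp r T a b c → IsCPDecomp r T a' b' c' →
      ∃ (σ : Equiv.Perm (Fin r)) (lam mu nu : Fin r → ℝ),
        (∀ k, lam k * mu k * nu k = 1) ∧
        (∀ k i, a' k i = lam k * a (σ k) i) ∧
        (∀ k j, b' k j = mu k * b (σ k) j) ∧
        (∀ k l, c' k l = nu k * c (σ k) l)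

lemma symT_prod {m s : ℕ} (a : ℝ) (v : Fin m → ℝ) :
    SymT (fun β : Fin s → Fin m => a * ∏ t, v (β t)) := by
  intro σ α
  simp only [Function.comp]
  rw [Equiv.prod_comp σ (fun t => v (α t))]

lemma toMs {m s : ℕ} (β : Fin s → Fin m) :
    Finsupp.toMultiset (∑ t, Finsupp.single (β t) 1) = Multiset.map β Finset.univ.val := by
  rw [map_sum]
  simp only [Finsupp.toMultiset_single, one_smul]
  rw [Finset.sum]
  have := Multiset.sum_map_singleton (Multiset.map β Finset.univ.val)
  rw [Multiset.map_map] at this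
  exact this

lemma exists_perm {m s : ℕ} (α β : Fin s → Fin m)
    (h : Multiset.map α Finset.univ.val = Multiset.map β Finset.univ.val) :
    ∃ σ : Equiv.Perm (Fin s), α = β ∘ σ := by
  classical
  have e : ∀ j, Nonempty ({t // α t = j} ≃ {t // β t = j}) := by
    intro j
    apply Fintype.card_eq.1
    have := congrArg (Multiset.count j) h
    rw [Multiset.count_map, Multiset.count_map] at this
    rw [Fintype.card_subtype, Fintype.card_subtype]
    simp only [@eq_comm _ j] at this
    exact this
  exact ⟨Equiv.ofFiberEquiv fun j => (e j).some, by
    funext t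
    exact (Equiv.ofFiberEquiv_map _ t).symm⟩

lemma sym_zero {m d : ℕ} (D : (s : Fin d) → (Fin ((s : ℕ) + 1) → Fin m) → ℝ)
    (hD : ∀ s, SymT (D s))
    (h : ∀ u : Fin m → ℝ, ∑ s : Fin d, ∑ α : Fin ((s : ℕ) + 1) → Fin m, D s α * ∏ t, u (α t) = 0)
    (s0 : Fin d) (β0 : Fin ((s0 : ℕ) + 1) → Fin m) : D s0 β0 = 0 := by
  classical
  let P : MvPolynomial (Fin m) ℝ := ∑ s : Fin d, ∑ α : Fin ((s : ℕ) + 1) → Fin m,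
    MvPolynomial.monomial (∑ t, Finsupp.single (α t) 1) (D s α)
  have hP : P = 0 := by
    apply MvPolynomial.funext
    intro u
    rw [map_zero, ← h u]
    simp only [P, map_sum]
    refine Finset.sum_congr rfl fun s _ => Finset.sum_congr rfl fun α _ => ?_
    have : MvPolynomial.monomial (∑ t, Finsupp.single (α t) 1) (D s α)
        = MvPolynomial.C (D s α) * ∏ t, MvPolynomial.X (α t) := by
      have h2 := MvPolynomial.monomial_sum_one (R := ℝ) Finset.univ
        (fun t => Finsupp.single (α t) 1)
      have : ∏ t, (MvPolynomial.X (α t) : MvPolynomial (Fin m) ℝ)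
        = MvPolynomial.monomial (∑ t, Finsupp.single (α t) 1) 1 := h2.symm
      rw [this, MvPolynomial.C_mul_monomial, mul_one]
    rw [this, map_mul, MvPolynomial.eval_C, map_prod]
    simp
  have hc := congrArg (MvPolynomial.coeff (∑ t, Finsupp.single (β0 t) 1)) hP
  simp only [P, MvPolynomial.coeff_sum, MvPolynomial.coeff_monomial, MvPolynomial.coeff_zero] at hc
  have key : ∀ (s : Fin d) (α : Fin ((s : ℕ) + 1) → Fin m),
      (∑ t, Finsupp.single (α t) 1 : Fin m →₀ ℕ) = ∑ t, Finsupp.single (β0 t) 1 →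
      s = s0 ∧ D s α = D s0 β0 := by
    intro s α e
    have e2 := congrArg Finsupp.toMultiset e
    rw [toMs, toMs] at e2
    have e3 := congrArg Multiset.card e2
    have e4 : s = s0 := by
      apply Fin.ext
      simpa using e3
    subst e4
    refine ⟨rfl, ?_⟩
    obtain ⟨σ, hσ⟩ := exists_perm α β0 e2
    rw [hσ, hD s]
  have h3 : ∑ s : Fin d, ∑ α : Fin ((s : ℕ) + 1) → Fin m,
      (if (∑ t, Finsupp.single (α t) 1 : Fin m →₀ ℕ) = ∑ t, Finsupp.single (β0 t) 1
        then (1 : ℝ) else 0) * D s0 β0 = 0 := by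
    refine Eq.trans ?_ hc
    refine Finset.sum_congr rfl fun s _ => Finset.sum_congr rfl fun α _ => ?_
    split_ifs with e
    · rw [(key s α e).2, one_mul]
    · rw [zero_mul]
  simp only [← Finset.sum_mul] at h3
  rcases mul_eq_zero.1 h3 with h4 | h4
  · exfalso
    rw [Finset.sum_eq_zero_iff_of_nonneg
      (fun s _ => Finset.sum_nonneg fun α _ => by split_ifs <;> norm_num)] at h4
    have h5 := h4 s0 (Finset.mem_univ _)
    rw [Finset.sum_eq_zero_iff_of_nonneg (fun α _ => by split_ifs <;> norm_num)] at h5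
    have h6 := h5 β0 (Finset.mem_univ _)
    simp at h6
  · exact h4

lemma rank_one {I J K : Type*} [Fintype I] [Fintype J] [Fintype K] (T : I → J → K → ℝ)
    (h : cpRank T ≤ 1) :
    ∃ (a : I → ℝ) (b : J → ℝ) (c : K → ℝ), ∀ i j k, T i j k = a i * b j * c k := by
  classical
  have hne : {r | ∃ a b c, IsCPDecomp r T a b c}.Nonempty := by
    let e := Fintype.equivFin (I × J × K)
    refine ⟨Fintype.card (I × J × K), fun l i => if (e.symm l).1 = i then 1 else 0,
      fun l j => if (e.symm l).2.1 = j then 1 else 0,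
      fun l k => if (e.symm l).2.2 = k then T (e.symm l).1 (e.symm l).2.1 k else 0, ?_⟩
    intro i j k
    rw [Equiv.sum_comp e.symm (fun x : I × J × K => (if x.1 = i then (1 : ℝ) else 0) *
      (if x.2.1 = j then 1 else 0) * (if x.2.2 = k then T x.1 x.2.1 k else 0))]
    rw [Finset.sum_eq_single (i, j, k)]
    · simp
    · rintro ⟨i', j', k'⟩ _ hx
      by_cases h1 : i' = i
      · by_cases h2 : j' = j
        · by_cases h3 : k' = k
          · subst h1 h2 h3; exact absurd rfl hx
          · simp [h3]
        · simp [h2]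
      · simp [h1]
    · simp
  obtain ⟨a, b, c, habc⟩ := Nat.sInf_mem hne
  change cpRank T ≤ 1 at h
  change ∀ i j k, _ at habc
  generalize hr : sInf {r | ∃ a b c, IsCPDecomp r T a b c} = r at *
  have h' : r ≤ 1 := by rw [← hr]; exact h
  interval_cases r
  · exact ⟨0, 0, 0, fun i j k => by rw [habc]; simp⟩
  · exact ⟨a 0, b 0, c 0, fun i j k => by rw [habc]; simp⟩

lemma sym_rank_one {m s : ℕ} (T : (Fin (s + 1) → Fin m) → ℝ) (hT : SymT T)
    (b : Fin m → ℝ) (C : (Fin s → Fin m) → ℝ)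
    (h : ∀ j α, T (Fin.cons j α) = b j * C α) (j0 : Fin m) (hj : b j0 ≠ 0)
    (β : Fin (s + 1) → Fin m) :
    T β = T (fun _ => j0) / b j0 ^ (s + 1) * ∏ t, b (β t) := by
  classical
  have h0 : ∀ (γ : Fin (s + 1) → Fin m), T (Function.update γ 0 j0) * b (γ 0) = b j0 * T γ := by
    intro γ
    have e1 : T γ = b (γ 0) * C (Fin.tail γ) := by rw [← h, Fin.cons_self_tail]
    have e2 : Function.update γ 0 j0 = Fin.cons j0 (Fin.tail γ) := by
      conv_lhs => rw [← Fin.cons_self_tail γ]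
      rw [Fin.update_cons_zero]
    rw [e1, e2, h]; ring
  have h1 : ∀ (γ : Fin (s + 1) → Fin m) (t : Fin (s + 1)),
      T (Function.update γ t j0) * b (γ t) = b j0 * T γ := by
    intro γ t
    have e := h0 (γ ∘ Equiv.swap 0 t)
    rw [hT] at e
    have e2 : Function.update (γ ∘ Equiv.swap 0 t) 0 j0
        = Function.update γ t j0 ∘ Equiv.swap 0 t := by
      rw [Function.update_comp_equiv]; simp
    rw [e2, hT] at e
    simpa using e
  have h2 : ∀ S : Finset (Fin (s + 1)),
      T β * b j0 ^ S.card = T (fun t => if t ∈ S then j0 else β t) * ∏ t ∈ S, b (β t) := by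
    intro S
    induction S using Finset.induction_on with
    | empty => simp
    | insert x S hx ih =>
      rw [Finset.card_insert_of_notMem hx, Finset.prod_insert hx, pow_succ, ← mul_assoc, ih]
      have e := h1 (fun t => if t ∈ S then j0 else β t) x
      have e2 : Function.update (fun t => if t ∈ S then j0 else β t) x j0
          = fun t => if t ∈ insert x S then j0 else β t := by
        funext t
        by_cases ht : t = x
        · subst ht; simp
        · simp [ht]
      rw [e2] at e
      simp only [hx, if_false] at e
      linear_combination (-∏ t ∈ S, b (β t)) * e
  have h3 := h2 Finset.univ
  simp only [Finset.card_univ, Fintype.card_fin, Finset.mem_univ, if_true] at h3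
  rw [div_mul_eq_mul_div, eq_div_iff (pow_ne_zero _ hj), h3]

lemma branch {m n d : ℕ}
    (Φ : (i : Fin n) → (s : Fin d) → (Fin ((s : ℕ) + 1) → Fin m) → ℝ)
    (hsym : ∀ i s, SymT (Φ i s)) (h : cpRank (coeffTensor Φ) ≤ 1) :
    ∃ (v : Fin m → ℝ) (w : Fin n → ℝ) (c : Fin d → ℝ),
      ∀ i s β, Φ i s β = w i * c s * ∏ t, v (β t) := by
  obtain ⟨a, b, c, habc⟩ := rank_one _ h
  have hΦ : ∀ i s β, Φ i s β = a i * b (β 0) * c ⟨s, Fin.tail β⟩ := by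
    intro i s β
    rw [← habc]
    simp only [coeffTensor]
    rw [Fin.cons_self_tail]
  by_cases ha : ∃ i, a i ≠ 0
  · by_cases hb : ∃ j, b j ≠ 0
    · obtain ⟨i0, hi⟩ := ha
      obtain ⟨j0, hj⟩ := hb
      refine ⟨b, a, fun s => Φ i0 s (fun _ => j0) / b j0 ^ ((s : ℕ) + 1) / a i0, ?_⟩
      intro i s β
      have e := sym_rank_one (Φ i0 s) (hsym i0 s) b (fun α => a i0 * c ⟨s, α⟩)
        (fun j α => by rw [hΦ]; simp; ring) j0 hj β
      have e2 : Φ i s β = a i * (Φ i0 s β / a i0) := by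
        rw [hΦ, hΦ]; field_simp
      rw [e2, e]; ring
    · push Not at hb
      exact ⟨0, 0, 0, fun i s β => by rw [hΦ, hb]; simp⟩
  · push Not at ha
    exact ⟨0, 0, 0, fun i s β => by rw [hΦ, ha]; simp⟩

lemma eval_sum {m n d r : ℕ} (v : Fin r → Fin m → ℝ) (w : Fin r → Fin n → ℝ)
    (c : Fin r → Fin d → ℝ) (u : Fin m → ℝ) (i : Fin n) :
    ∑ k, w k i * ∑ s : Fin d, c k s * (∑ j, v k j * u j) ^ ((s : ℕ) + 1)
      = polyEval (fun i s β => ∑ k, w k i * c k s * ∏ t, v k (β t)) u i := by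
  simp only [polyEval, Finset.mul_sum, Finset.sum_mul]
  rw [Finset.sum_comm]
  refine Finset.sum_congr rfl fun s _ => ?_
  rw [Finset.sum_comm]
  refine Finset.sum_congr rfl fun k _ => ?_
  have : (∑ j, v k j * u j) ^ ((s : ℕ) + 1)
      = ∑ β : Fin ((s : ℕ) + 1) → Fin m, ∏ t, (v k (β t) * u (β t)) := by
    exact Fintype.sum_pow _ _
  rw [this, Finset.mul_sum, Finset.mul_sum]
  refine Finset.sum_congr rfl fun β _ => ?_
  rw [Finset.prod_mul_distrib]; ring

/-- a degree-`d` polynomial map `f` with coefficient tensor `Q` admits a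
decoupled representation with `r` branches if and only if `Q = Q_1 + ⋯ + Q_r` where each
`Q_k` has CP rank at most `1` and lies in the linear subspace `L_Q` of coefficient tensors
of degree-`d` polynomial maps. -/
theorem stmt15 (m n d r : ℕ)
    (Φ : (i : Fin n) → (s : Fin d) → (Fin ((s : ℕ) + 1) → Fin m) → ℝ)
    (hsym : ∀ i s, SymT (Φ i s)) :
    (∃ (v : Fin r → Fin m → ℝ) (w : Fin r → Fin n → ℝ) (c : Fin r → Fin d → ℝ),
        ∀ (u : Fin m → ℝ) (i : Fin n), polyEval Φ u i
          = ∑ k, w k i * ∑ s : Fin d, c k s * (∑ j, v k j * u j) ^ ((s : ℕ) + 1))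
      ↔ ∃ Qs : Fin r → (Fin n → Fin m → DeltaIdx m d → ℝ),
          (∀ k, cpRank (Qs k) ≤ 1) ∧
          (∀ k, ∃ Φ' : (i : Fin n) → (s : Fin d) → (Fin ((s : ℕ) + 1) → Fin m) → ℝ,
            (∀ i s, SymT (Φ' i s)) ∧ Qs k = coeffTensor Φ') ∧
          (∀ (i : Fin n) (j : Fin m) (p : DeltaIdx m d),
            coeffTensor Φ i j p = ∑ k, Qs k i j p) := by
  constructor
  · rintro ⟨v, w, c, h⟩
    refine ⟨fun k => coeffTensor (fun i s β => w k i * c k s * ∏ t, v k (β t)), ?_, ?_, ?_⟩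
    · intro k
      refine Nat.sInf_le ⟨fun _ => w k, fun _ => v k,
        fun _ p => c k p.1 * ∏ t, v k (p.2 t), ?_⟩
      intro i j p
      simp only [coeffTensor, Fin.prod_univ_succ, Fin.cons_zero, Fin.cons_succ]
      simp
      ring
    · intro k
      exact ⟨_, fun i s => symT_prod _ _, rfl⟩
    · intro i j p
      have hz := sym_zero
        (fun s β => Φ i s β - ∑ k, w k i * c k s * ∏ t, v k (β t))
        (by
          intro s σ α
          have := hsym i s σ α
          simp only [this]
          congr 1
          exact Finset.sum_congr rfl fun k _ => symT_prod (w k i * c k s) (v k) σ α)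
        (by
          intro u
          have := h u i
          rw [eval_sum] at this
          simp only [polyEval] at this
          simp only [sub_mul, Finset.sum_sub_distrib]
          rw [this, sub_self])
        p.1 (Fin.cons j p.2)
      exact sub_eq_zero.1 hz
  · rintro ⟨Qs, h1, h2, h3⟩
    choose Φ' hs hQ using h2
    have hb : ∀ k, ∃ (v : Fin m → ℝ) (w : Fin n → ℝ) (c : Fin d → ℝ),
      ∀ i s β, Φ' k i s β = w i * c s * ∏ t, v (β t) := fun k =>
        branch (Φ' k) (hs k) (by rw [← hQ]; exact h1 k)
    choose v w c hv using hb
    refine ⟨v, w, c, fun u i => ?_⟩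
    rw [eval_sum]
    have : Φ = fun i s β => ∑ k, w k i * c k s * ∏ t, v k (β t) := by
      funext i s β
      have e := h3 i (β 0) ⟨s, Fin.tail β⟩
      simp only [hQ, coeffTensor] at e
      rw [Fin.cons_self_tail] at e
      rw [e]
      exact Finset.sum_congr rfl fun k _ => hv k i s β
    rw [← this]
end

section
/- Let f : ℝ^m → ℝ^n be a polynomial map of degree d, let u^{(1)},…,u^{(N)} ∈ ℝ^m be sampling points whose Vandermonde-like matrix A ∈ ℝ^{δ×N} has rank M = C(m+d−1, d−1), let J ∈ ℝ^{n×m×N} be the Jacobian tensor of f at these points, and let L_J ⊆ ℝ^{n×m×N} denote the linear subspace of all tensors arising as the Jacobian tensor of some polynomial map ℝ^m → ℝ^n of degree d at the same sampling points. Then f admits a decoupled representation f(u) = Σ_{k=1}^r w_k g_k(v_k^T u) with r branches if and only if J can be written as J = J_1 + ⋯ + J_r, where each J_k has CP rank at most 1 and J_k ∈ L_J. -/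
open scoped BigOperators

/-- monomial function -/
def mono16 {m d : ℕ} (p : DeltaIdx m d) : (Fin m → ℝ) → ℝ := fun u => ∏ i, u (p.2 i)

/-- span of the monomials of degree at most `d-1` -/
def W16 (m d : ℕ) : Submodule ℝ ((Fin m → ℝ) → ℝ) := Submodule.span ℝ (Set.range (mono16 (m := m) (d := d)))

/-- monomials by multisets -/
def symMono (m e : ℕ) (S : Sym (Option (Fin m)) e) : (Fin m → ℝ) → ℝ :=
  fun u => ((S : Multiset (Option (Fin m))).map (fun o => o.elim 1 u)).prod

lemma W16_finrank (m d : ℕ) : Module.finrank ℝ (W16 m d) ≤ (m + d - 1).choose (d - 1) := by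
  have hle : W16 m d ≤ Submodule.span ℝ (Set.range (symMono m (d-1))) := by
    apply Submodule.span_mono
    rintro _ ⟨⟨s, β⟩, rfl⟩
    have hs : (s : ℕ) ≤ d - 1 := by have := s.2; omega
    refine ⟨⟨(Finset.univ.val.map (fun t => some (β t))) + Multiset.replicate (d - 1 - s) none, ?_⟩, ?_⟩
    · simp; omega
    · funext u
      simp only [symMono, mono16, Sym.coe_mk, Multiset.map_add, Multiset.map_map, Multiset.prod_add,
        Multiset.map_replicate, Option.elim, Multiset.prod_replicate, one_pow, mul_one]
      rfl
  have : FiniteDimensional ℝ (Submodule.span ℝ (Set.range (symMono m (d-1)))) :=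
    FiniteDimensional.span_of_finite ℝ (Set.finite_range _)
  have h1 := Submodule.finrank_mono hle
  have h2 := finrank_range_le_card (R := ℝ) (symMono m (d-1))
  have h3 : Fintype.card (Sym (Option (Fin m)) (d-1)) = (m + d - 1).choose (d-1) ∨ d = 0 := by
    rcases Nat.eq_zero_or_pos d with h | h
    · exact Or.inr h
    · left
      rw [Sym.card_sym_eq_choose]
      simp
      congr 1
      omega
  rcases h3 with h3 | h3
  · rw [← h3]; exact h1.trans h2
  · subst h3
    have : W16 m 0 = ⊥ := by
      unfold W16
      rw [Submodule.span_eq_bot]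
      rintro _ ⟨⟨s, _⟩, _⟩
      exact s.elim0
    rw [this]; simp

lemma W16_zero {m d N : ℕ} (pts : Fin N → Fin m → ℝ)
    (hA : (vdm m d N pts).rank = (m + d - 1).choose (d - 1))
    (g : (Fin m → ℝ) → ℝ) (hg : g ∈ W16 m d) (h0 : ∀ l, g (pts l) = 0) : g = 0 := by
  have : FiniteDimensional ℝ (W16 m d) := FiniteDimensional.span_of_finite ℝ (Set.finite_range _)
  let E : ((Fin m → ℝ) → ℝ) →ₗ[ℝ] (Fin N → ℝ) := LinearMap.funLeft ℝ ℝ pts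
  let R := E.domRestrict (W16 m d)
  have h1 : Submodule.span ℝ (Set.range (vdm m d N pts).row) ≤ LinearMap.range R := by
    rw [Submodule.span_le]
    rintro _ ⟨p, rfl⟩
    refine ⟨⟨((p.1 : ℕ) + 1 : ℝ) • mono16 p, Submodule.smul_mem _ _ (Submodule.subset_span ⟨p, rfl⟩)⟩, ?_⟩
    funext l
    simp [R, E, vdm, mono16, LinearMap.funLeft, Matrix.row]
  have h2 := Submodule.finrank_mono h1
  rw [← Matrix.rank_eq_finrank_span_row, hA] at h2
  have h3 := R.finrank_range_add_finrank_ker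
  have h4 := W16_finrank m d
  have h5 : Module.finrank ℝ (LinearMap.ker R) = 0 := by omega
  have h6 := Submodule.finrank_eq_zero.mp h5
  have h7 : (⟨g, hg⟩ : W16 m d) ∈ LinearMap.ker R := by
    rw [LinearMap.mem_ker]
    funext l
    simpa [R, E, LinearMap.funLeft] using h0 l
  rw [h6] at h7
  simpa using h7

/-- partial derivative -/
noncomputable def D16 {m : ℕ} (h : (Fin m → ℝ) → ℝ) (j : Fin m) (u : Fin m → ℝ) : ℝ :=
  fderiv ℝ h u (Pi.single j 1)

/-- good functions -/
def Good16 {m : ℕ} (d : ℕ) (h : (Fin m → ℝ) → ℝ) : Prop :=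
  Differentiable ℝ h ∧ h 0 = 0 ∧ ∀ j, D16 h j ∈ W16 m d

lemma Good16.add {m d : ℕ} {h g : (Fin m → ℝ) → ℝ} (hh : Good16 d h) (hg : Good16 d g) :
    Good16 d (fun u => h u + g u) ∧ ∀ j u, D16 (fun u => h u + g u) j u = D16 h j u + D16 g j u := by
  have key : ∀ j u, D16 (fun u => h u + g u) j u = D16 h j u + D16 g j u := by
    intro j u
    unfold D16
    rw [fderiv_fun_add (hh.1 u) (hg.1 u)]; rfl
  refine ⟨⟨hh.1.add hg.1, by simp [hh.2.1, hg.2.1], fun j => ?_⟩, key⟩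
  have : D16 (fun u => h u + g u) j = D16 h j + D16 g j := funext (key j)
  rw [this]
  exact Submodule.add_mem _ (hh.2.2 j) (hg.2.2 j)

lemma Good16.smul {m d : ℕ} {h : (Fin m → ℝ) → ℝ} (a : ℝ) (hh : Good16 d h) :
    Good16 d (fun u => a * h u) ∧ ∀ j u, D16 (fun u => a * h u) j u = a * D16 h j u := by
  have key : ∀ j u, D16 (fun u => a * h u) j u = a * D16 h j u := by
    intro j u
    unfold D16
    rw [fderiv_const_mul (hh.1 u)]; rfl
  refine ⟨⟨hh.1.const_mul a, by simp [hh.2.1], fun j => ?_⟩, key⟩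
  have : D16 (fun u => a * h u) j = a • D16 h j := funext (key j)
  rw [this]
  exact Submodule.smul_mem _ _ (hh.2.2 j)

lemma Good16.zero {m d : ℕ} :
    Good16 d (fun _ : Fin m → ℝ => (0:ℝ)) ∧ ∀ j u, D16 (fun _ : Fin m → ℝ => (0:ℝ)) j u = 0 := by
  have key : ∀ j u, D16 (fun _ : Fin m → ℝ => (0:ℝ)) j u = 0 := by
    intro j u; simp [D16]
  refine ⟨⟨by fun_prop, rfl, fun j => ?_⟩, key⟩
  have : D16 (fun _ : Fin m → ℝ => (0:ℝ)) j = 0 := funext (key j)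
  rw [this]; exact Submodule.zero_mem _

lemma Good16.sum {m d : ℕ} {ι : Type*} (S : Finset ι) {h : ι → (Fin m → ℝ) → ℝ}
    (hh : ∀ k, Good16 d (h k)) :
    Good16 d (fun u => ∑ k ∈ S, h k u) ∧
      ∀ j u, D16 (fun u => ∑ k ∈ S, h k u) j u = ∑ k ∈ S, D16 (h k) j u := by
  classical
  induction S using Finset.induction_on with
  | empty => simpa using Good16.zero
  | insert a S ha ih =>
    simp only [Finset.sum_insert ha]
    obtain ⟨h1, h2⟩ := Good16.add (hh a) ih.1
    exact ⟨h1, fun j u => by rw [h2, ih.2]⟩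

lemma Good16.mono {m d : ℕ} (s : Fin d) (α : Fin ((s : ℕ) + 1) → Fin m) :
    Good16 d (fun u : Fin m → ℝ => ∏ t, u (α t)) := by
  have hd : ∀ u, HasFDerivAt (fun u : Fin m → ℝ => ∏ t, u (α t))
      (∑ t, (∏ t' ∈ Finset.univ.erase t, u (α t')) •
        (ContinuousLinearMap.proj (R := ℝ) (φ := fun _ : Fin m => ℝ) (α t))) u := by
    intro u
    exact HasFDerivAt.finsetProd (fun t _ => hasFDerivAt_apply (α t) u)
  refine ⟨fun u => (hd u).differentiableAt, by simp, fun j => ?_⟩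
  have : D16 (fun u : Fin m → ℝ => ∏ t, u (α t)) j =
      ∑ t, (Pi.single j (1:ℝ) : Fin m → ℝ) (α t) • mono16 (⟨s, fun t' => α (t.succAbove t')⟩ : DeltaIdx m d) := by
    funext u
    unfold D16
    rw [(hd u).fderiv]
    simp only [sum_apply, smul_apply, Finset.sum_apply,
      Pi.smul_apply, mono16, smul_eq_mul, ContinuousLinearMap.proj_apply]
    refine Finset.sum_congr rfl fun t _ => ?_
    rw [mul_comm]
    congr 1
    rw [← Finset.compl_singleton, ← Fin.image_succAbove_univ,
      Finset.prod_image (fun _ _ _ _ h => Fin.succAbove_right_injective h)]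
  rw [this]
  exact Submodule.sum_mem _ fun t _ => Submodule.smul_mem _ _ (Submodule.subset_span ⟨_, rfl⟩)

lemma Good16.poly {m n d : ℕ}
    (Φ : (i : Fin n) → (s : Fin d) → (Fin ((s : ℕ) + 1) → Fin m) → ℝ) (i : Fin n) :
    Good16 d (fun u => polyEval Φ u i) := by
  unfold polyEval
  exact (Good16.sum _ fun s => (Good16.sum _ fun α => (Good16.smul _ (Good16.mono s α)).1).1).1

lemma D16_sum {m : ℕ} (h : (Fin m → ℝ) → ℝ) (u x : Fin m → ℝ) :
    fderiv ℝ h u x = ∑ j, x j * D16 h j u := by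
  conv_lhs => rw [pi_eq_sum_univ' x]
  simp [D16, map_sum, map_smul]

lemma D16_zero {m d : ℕ} {h : (Fin m → ℝ) → ℝ} (hh : Good16 d h) (h0 : ∀ j u, D16 h j u = 0) (u) :
    h u = 0 := by
  rw [← hh.2.1]
  refine is_const_of_fderiv_eq_zero hh.1 (fun u => ?_) _ _
  ext x
  rw [D16_sum]
  simp [h0]

lemma line16 {m d : ℕ} {h : (Fin m → ℝ) → ℝ} (hh : Good16 d h) (y x : Fin m → ℝ)
    (h0 : ∀ u, fderiv ℝ h u x = 0) : h (y + x) = h y := by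
  have hd : ∀ t : ℝ, HasDerivAt (fun t : ℝ => h (y + t • x)) 0 t := by
    intro t
    have h1 : HasDerivAt (fun t : ℝ => y + t • x) x t := by
      simpa using ((hasDerivAt_id t).smul_const x).const_add y
    have h2 := (hh.1 (y + t • x)).hasFDerivAt.comp_hasDerivAt t h1
    rw [h0] at h2
    exact h2
  have := is_const_of_deriv_eq_zero (fun t => (hd t).differentiableAt) (fun t => (hd t).deriv) 1 0
  simpa using this

lemma polyEval_smul {m n d : ℕ}
    (Φ : (i : Fin n) → (s : Fin d) → (Fin ((s : ℕ) + 1) → Fin m) → ℝ) (i : Fin n)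
    (a : ℝ) (e : Fin m → ℝ) :
    polyEval Φ (a • e) i = ∑ s : Fin d, (∑ α, Φ i s α * ∏ t, e (α t)) * a ^ ((s : ℕ) + 1) := by
  unfold polyEval
  refine Finset.sum_congr rfl fun s _ => ?_
  rw [Finset.sum_mul]
  refine Finset.sum_congr rfl fun α _ => ?_
  simp [Finset.prod_mul_distrib]
  ring

lemma rankone16 {m n d N : ℕ} (pts : Fin N → Fin m → ℝ)
    (hA : (vdm m d N pts).rank = (m + d - 1).choose (d - 1))
    (Φ : (i : Fin n) → (s : Fin d) → (Fin ((s : ℕ) + 1) → Fin m) → ℝ)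
    (a : Fin n → ℝ) (b : Fin m → ℝ) (c : Fin N → ℝ)
    (hJ : ∀ i j l, D16 (fun u => polyEval Φ u i) j (pts l) = a i * b j * c l) :
    ∃ (v : Fin m → ℝ) (w : Fin n → ℝ) (c : Fin d → ℝ), ∀ u i,
      polyEval Φ u i = w i * ∑ s : Fin d, c s * (∑ j, v j * u j) ^ ((s : ℕ) + 1) := by
  by_cases hz : a = 0 ∨ b = 0
  · refine ⟨0, 0, 0, fun u i => ?_⟩
    have := D16_zero (Good16.poly Φ i) (fun j u => congrFun
      (W16_zero pts hA _ ((Good16.poly Φ i).2.2 j) (fun l => by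
        rw [hJ]; rcases hz with rfl | rfl <;> simp)) u) u
    simpa using this
  · push Not at hz
    obtain ⟨i0, hi⟩ := Function.ne_iff.mp hz.1
    obtain ⟨j0, hj⟩ := Function.ne_iff.mp hz.2
    simp only [Pi.zero_apply] at hi hj
    have hG := Good16.poly Φ
    -- proportional components
    have hprop : ∀ u i, polyEval Φ u i = (a i / a i0) * polyEval Φ u i0 := by
      intro u i
      obtain ⟨g1, k1⟩ := Good16.smul (-(a i / a i0)) (hG i0)
      obtain ⟨g2, k2⟩ := Good16.add (hG i) g1
      have := D16_zero g2 (fun j u => congrFun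
        (W16_zero pts hA _ (g2.2.2 j) (fun l => by
          rw [k2, k1, hJ, hJ]; field_simp; ring)) u) u
      linarith
    have hgrad : ∀ j u, b j0 * D16 (fun u => polyEval Φ u i0) j u
        = b j * D16 (fun u => polyEval Φ u i0) j0 u := by
      intro j u
      have := congrFun (W16_zero pts hA
        (b j0 • D16 (fun u => polyEval Φ u i0) j - b j • D16 (fun u => polyEval Φ u i0) j0)
        (Submodule.sub_mem _ (Submodule.smul_mem _ _ ((hG i0).2.2 j))
          (Submodule.smul_mem _ _ ((hG i0).2.2 j0)))
        (fun l => by simp [hJ]; ring)) u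
      simp at this
      linarith
    let e : Fin m → ℝ := Pi.single j0 (b j0)⁻¹
    refine ⟨b, fun i => a i / a i0, fun s => ∑ α, Φ i0 s α * ∏ t, e (α t), fun u i => ?_⟩
    rw [hprop, ← polyEval_smul]
    congr 1
    have := line16 (hG i0) ((∑ j, b j * u j) • e) (u - (∑ j, b j * u j) • e) ?_
    · simpa using this
    · intro y
      rw [D16_sum]
      have h1 : ∀ j, D16 (fun u => polyEval Φ u i0) j y
          = b j * ((b j0)⁻¹ * D16 (fun u => polyEval Φ u i0) j0 y) := by
        intro j
        have := hgrad j y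
        field_simp
        linarith
      have h2 : ∑ j, (u - (∑ j, b j * u j) • e) j * b j = 0 := by
        simp only [Pi.sub_apply, Pi.smul_apply, smul_eq_mul, sub_mul, Finset.sum_sub_distrib]
        rw [sub_eq_zero, eq_comm, Finset.sum_eq_single j0]
        · simp only [e, Pi.single_eq_same]
          rw [mul_assoc, inv_mul_cancel₀ hj, mul_one]
          exact Finset.sum_congr rfl fun _ _ => mul_comm _ _
        · intro j _ hne
          simp [e, hne]
        · simp
      calc _ = ∑ j, ((u - (∑ j, b j * u j) • e) j * b j) *
            ((b j0)⁻¹ * D16 (fun u => polyEval Φ u i0) j0 y) :=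
            Finset.sum_congr rfl fun j _ => by rw [h1 j]; ring
        _ = 0 := by rw [← Finset.sum_mul, h2, zero_mul]

lemma cp16 {n m N : ℕ} (T : Fin n → Fin m → Fin N → ℝ) (h : cpRank T ≤ 1) :
    ∃ (a : Fin n → ℝ) (b : Fin m → ℝ) (c : Fin N → ℝ), ∀ i j l, T i j l = a i * b j * c l := by
  have hne : {r | ∃ a b c, IsCPDecomp r T a b c}.Nonempty := by
    refine ⟨Fintype.card (Fin n × Fin m),
      fun q i => if ((Fintype.equivFin (Fin n × Fin m)).symm q).1 = i then 1 else 0,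
      fun q j => if ((Fintype.equivFin (Fin n × Fin m)).symm q).2 = j then 1 else 0,
      fun q l => T ((Fintype.equivFin (Fin n × Fin m)).symm q).1
        ((Fintype.equivFin (Fin n × Fin m)).symm q).2 l, fun i j l => ?_⟩
    rw [Equiv.sum_comp (Fintype.equivFin (Fin n × Fin m)).symm
      (fun p => (if p.1 = i then (1:ℝ) else 0) * (if p.2 = j then 1 else 0) * T p.1 p.2 l)]
    simp [Fintype.sum_prod_type]
  have hmem : ∃ a b c, IsCPDecomp (cpRank T) T a b c := Nat.sInf_mem hne
  obtain ⟨a, b, c, hd⟩ := hmem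
  generalize cpRank T = R at *
  interval_cases R
  · exact ⟨0, 0, 0, fun i j l => by simpa using hd i j l⟩
  · exact ⟨a 0, b 0, c 0, fun i j l => by simpa using hd i j l⟩

lemma polyEval_rank {m n d : ℕ} (v : Fin m → ℝ) (w : Fin n → ℝ) (c : Fin d → ℝ) (u : Fin m → ℝ)
    (i : Fin n) :
    polyEval (fun i s α => w i * (c s * ∏ t, v (α t))) u i
      = w i * ∑ s : Fin d, c s * (∑ j, v j * u j) ^ ((s : ℕ) + 1) := by
  unfold polyEval
  rw [Finset.mul_sum]
  refine Finset.sum_congr rfl fun s _ => ?_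
  rw [Fintype.sum_pow, Finset.mul_sum, Finset.mul_sum]
  refine Finset.sum_congr rfl fun α _ => ?_
  rw [Finset.prod_mul_distrib]
  ring

lemma jac_rank {m n d : ℕ} (v : Fin m → ℝ) (w : Fin n → ℝ) (c : Fin d → ℝ) (u : Fin m → ℝ)
    (i : Fin n) (j : Fin m) :
    D16 (fun u => w i * ∑ s : Fin d, c s * (∑ j, v j * u j) ^ ((s : ℕ) + 1)) j u
      = w i * v j * ∑ s : Fin d, c s * (((s : ℕ) + 1) * (∑ j, v j * u j) ^ (s : ℕ)) := by
  have hd : DifferentiableAt ℝ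
      (fun u : Fin m → ℝ => w i * ∑ s : Fin d, c s * (∑ j, v j * u j) ^ ((s : ℕ) + 1)) u := by
    fun_prop
  unfold D16
  have h1 : HasDerivAt (fun t : ℝ => u + t • (Pi.single j 1 : Fin m → ℝ)) (Pi.single j 1) 0 := by
    simpa using ((hasDerivAt_id (0:ℝ)).smul_const (Pi.single j 1 : Fin m → ℝ)).const_add u
  have h2 := HasFDerivAt.comp_hasDerivAt_of_eq (0:ℝ) hd.hasFDerivAt h1 (by simp)
  have hlin : ∀ t : ℝ, ∑ j', v j' * (u + t • (Pi.single j 1 : Fin m → ℝ)) j'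
      = (∑ j, v j * u j) + t * v j := by
    intro t
    simp [mul_add, Finset.sum_add_distrib, Pi.single_apply, mul_comm]
  have h3 : HasDerivAt (fun t : ℝ => w i * ∑ s : Fin d, c s * ((∑ j, v j * u j) + t * v j) ^ ((s : ℕ) + 1))
      (w i * ∑ s : Fin d, c s * ((((s : ℕ) + 1 : ℕ) : ℝ) * ((∑ j, v j * u j) + 0 * v j) ^ (s : ℕ) * (1 * v j))) 0 := by
    refine HasDerivAt.const_mul _ (HasDerivAt.fun_sum fun s _ => HasDerivAt.const_mul _ ?_)
    exact (((hasDerivAt_id (0:ℝ)).mul_const (v j)).const_add (∑ j, v j * u j)).fun_pow ((s:ℕ)+1)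
  have h5 : (fun t : ℝ => w i * ∑ s : Fin d, c s * ((∑ j, v j * u j) + t * v j) ^ ((s : ℕ) + 1)) =
      ((fun u => w i * ∑ s, c s * (∑ j, v j * u j) ^ ((s : ℕ) + 1)) ∘
        fun t : ℝ => u + t • (Pi.single j 1 : Fin m → ℝ)) := by
    funext t
    simp only [Function.comp, hlin]
  rw [h5] at h3
  rw [h2.unique h3, mul_assoc]
  congr 1
  rw [Finset.mul_sum]
  refine Finset.sum_congr rfl fun s _ => ?_
  push_cast
  ring

/-- if the Vandermonde-like matrix of the sampling points has full rank
`M = C(m+d-1, d-1)`, then a degree-`d` polynomial map `f` with Jacobian tensor `J` admits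
a decoupled representation with `r` branches if and only if `J = J_1 + ⋯ + J_r` where each
`J_k` has CP rank at most `1` and lies in the linear subspace `L_J` of Jacobian tensors of
degree-`d` polynomial maps at the same sampling points. -/
theorem stmt16 (m n d N r : ℕ)
    (Φ : (i : Fin n) → (s : Fin d) → (Fin ((s : ℕ) + 1) → Fin m) → ℝ)
    (hsym : ∀ i s, SymT (Φ i s))
    (pts : Fin N → Fin m → ℝ)
    (hA : (vdm m d N pts).rank = (m + d - 1).choose (d - 1)) :
    (∃ (v : Fin r → Fin m → ℝ) (w : Fin r → Fin n → ℝ) (c : Fin r → Fin d → ℝ),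
        ∀ (u : Fin m → ℝ) (i : Fin n), polyEval Φ u i
          = ∑ k, w k i * ∑ s : Fin d, c k s * (∑ j, v k j * u j) ^ ((s : ℕ) + 1))
      ↔ ∃ Js : Fin r → (Fin n → Fin m → Fin N → ℝ),
          (∀ k, cpRank (Js k) ≤ 1) ∧
          (∀ k, ∃ Φ' : (i : Fin n) → (s : Fin d) → (Fin ((s : ℕ) + 1) → Fin m) → ℝ,
            (∀ i s, SymT (Φ' i s)) ∧ Js k = jacTensor (polyEval Φ') pts) ∧
          (∀ (i : Fin n) (j : Fin m) (l : Fin N),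
            jacTensor (polyEval Φ) pts i j l = ∑ k, Js k i j l) := by
  constructor
  · rintro ⟨v, w, c, hf⟩
    refine ⟨fun k => jacTensor (polyEval (fun i s α => w k i * (c k s * ∏ t, v k (α t)))) pts,
      fun k => ?_, fun k => ⟨_, fun i s σ α => ?_, rfl⟩, fun i j l => ?_⟩
    · refine Nat.sInf_le ⟨fun _ => w k, fun _ => v k, fun _ l =>
        ∑ s : Fin d, c k s * (((s : ℕ) + 1) * (∑ j, v k j * pts l j) ^ (s : ℕ)), fun i j l => ?_⟩
      simp only [Finset.univ_unique, Finset.sum_singleton]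
      rw [← jac_rank (v k) (w k) (c k) (pts l) i j]
      simp only [jacTensor, D16, polyEval_rank]
    · simp only [Function.comp]
      rw [Equiv.prod_comp σ (fun t => v k (α t))]
    · have := (Good16.sum Finset.univ fun k =>
        Good16.poly (fun i s α => w k i * (c k s * ∏ t, v k (α t))) i).2 j (pts l)
      simp only [jacTensor]
      unfold D16 at this
      rw [← this]
      congr 2
      funext u
      rw [hf]
      exact Finset.sum_congr rfl fun k _ => (polyEval_rank _ _ _ _ _).symm
  · rintro ⟨Js, hcp, hL, hsum⟩
    choose Ψ _ hΨ using hL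
    have hk : ∀ k, ∃ (v : Fin m → ℝ) (w : Fin n → ℝ) (c : Fin d → ℝ), ∀ u i,
        polyEval (Ψ k) u i = w i * ∑ s : Fin d, c s * (∑ j, v j * u j) ^ ((s : ℕ) + 1) := by
      intro k
      obtain ⟨a, b, c, h⟩ := cp16 (Js k) (hcp k)
      refine rankone16 pts hA (Ψ k) a b c fun i j l => ?_
      rw [← h, hΨ]; rfl
    choose v w c hvwc using hk
    refine ⟨v, w, c, fun u i => ?_⟩
    simp only [← hvwc]
    obtain ⟨g0, k0⟩ := Good16.sum Finset.univ fun k => Good16.poly (Ψ k) i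
    obtain ⟨g1, k1⟩ := Good16.smul (-1) g0
    obtain ⟨g2, k2⟩ := Good16.add (Good16.poly Φ i) g1
    have := D16_zero g2 (fun j u => congrFun
      (W16_zero pts hA _ (g2.2.2 j) (fun l => by
        rw [k2, k1, k0]
        have := hsum i j l
        simp only [hΨ] at this
        unfold jacTensor at this
        unfold D16
        rw [this]; ring)) u) u
    linarith
end
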